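/- arXiv:2101.12705 — 3 statements merged into one kernel-verified Lean document; each statement's English description precedes it below -/
import Mathlib

section
/- Let S = ((X,d),(f_i)_{i∈I}) be a diameter diminishing to zero IFS. Then for every ω ∈ Λ(I) = I^{ℕ*} there exists a point a_ω ∈ X such that ⋂_{n≥1} closure(f_{[ω]_n}(B)) = {a_ω} for every nonempty bounded closed set B ⊆ X with F_S(B) ⊆ B; in particular the intersection is a singleton and does not depend on B. -/
open Metric Set Filter Bornology

/-- Composition of the maps of an IFS along a finite word:
`wordComp f [i₁,…,iₙ] = f i₁ ∘ … ∘ f iₙ`. -/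
def wordComp {I X : Type*} (f : I → X → X) : List I → X → X
  | [] => id
  | i :: l => f i ∘ wordComp f l

/-- The prefix `[ω]_n` of length `n` of an infinite word `ω ∈ Λ(I) = I^ℕ`. -/
def prefixList {I : Type*} (ω : ℕ → I) (n : ℕ) : List I :=
  List.ofFn fun k : Fin n => ω k

/-- The fractal operator of an IFS: `F_S(B)` is the closure of `⋃ i, f_i(B)`. -/
def fractalOp {I X : Type*} [MetricSpace X] (f : I → X → X) (B : Set X) : Set X :=
  closure (⋃ i, f i '' B)

/-- The IFS `(f_i)_{i ∈ I}` on `X` is diameter diminishing to zero: every nonempty bounded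
closed `B` is contained in a nonempty bounded closed `M_B` invariant under the fractal operator
with `max_{ω ∈ Iⁿ} diam (f_ω(M_B)) → 0`. -/
def IsDDZ {X I : Type*} [MetricSpace X] (f : I → X → X) : Prop :=
  ∀ B : Set X, B.Nonempty → IsBounded B → IsClosed B →
    ∃ M : Set X, M.Nonempty ∧ IsBounded M ∧ IsClosed M ∧ B ⊆ M ∧
      fractalOp f M ⊆ M ∧
      Tendsto (fun n : ℕ => ⨆ ω : Fin n → I, diam (wordComp f (List.ofFn ω) '' M))
        atTop (nhds 0)

theorem wordComp_append {I X : Type*} (f : I → X → X) (l l' : List I) :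
    wordComp f (l ++ l') = wordComp f l ∘ wordComp f l' := by
  induction l with
  | nil => rfl
  | cons i l ih => simp only [List.cons_append, wordComp, ih, Function.comp_assoc]

theorem prefixList_succ {I : Type*} (ω : ℕ → I) (n : ℕ) :
    prefixList ω (n + 1) = prefixList ω n ++ [ω n] := by
  rw [prefixList, List.ofFn_succ_last]
  rfl

section

variable {X I : Type*} [MetricSpace X] {f : I → X → X} {B : Set X}

theorem image_subset_of_fractalOp_subset (hB : fractalOp f B ⊆ B) (i : I) : f i '' B ⊆ B :=
  (subset_iUnion (fun j => f j '' B) i).trans (subset_closure.trans hB)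

theorem wordComp_image_subset (hB : fractalOp f B ⊆ B) (l : List I) :
    wordComp f l '' B ⊆ B := by
  induction l with
  | nil => simp [wordComp]
  | cons i l ih =>
    rw [wordComp, image_comp]
    exact (image_mono ih).trans (image_subset_of_fractalOp_subset hB i)

theorem antitone_wordComp_prefixList_image (hB : fractalOp f B ⊆ B) (ω : ℕ → I) :
    Antitone fun n => wordComp f (prefixList ω n) '' B := by
  refine antitone_nat_of_succ_le fun n => ?_
  rw [prefixList_succ, wordComp_append, image_comp]
  exact image_mono (wordComp_image_subset hB _)

theorem IsDDZ.tendsto_diam_prefixList [Finite I] (hf : IsDDZ f) (hne : B.Nonempty)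
    (hbd : IsBounded B) (hcl : IsClosed B) (ω : ℕ → I) :
    Tendsto (fun n => diam (wordComp f (prefixList ω n) '' B)) atTop (nhds 0) := by
  obtain ⟨M, -, hMb, -, hBM, hM, hlim⟩ := hf B hne hbd hcl
  refine squeeze_zero (fun _ => diam_nonneg) (fun n => ?_) hlim
  refine (diam_mono (image_mono hBM) (hMb.subset (wordComp_image_subset hM _))).trans ?_
  exact le_ciSup (f := fun σ : Fin n → I => diam (wordComp f (List.ofFn σ) '' M))
    (Set.finite_range _).bddAbove fun k : Fin n => ω k

theorem IsDDZ.exists_iInter_eq_singleton [CompleteSpace X] [Finite I] (hf : IsDDZ f)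
    (hne : B.Nonempty) (hbd : IsBounded B) (hcl : IsClosed B) (hB : fractalOp f B ⊆ B)
    (ω : ℕ → I) :
    ∃ a, (⋂ (n : ℕ) (_ : 1 ≤ n), closure (wordComp f (prefixList ω n) '' B)) = {a} := by
  have hanti := antitone_wordComp_prefixList_image hB ω
  have hb : ∀ n, IsBounded (closure (wordComp f (prefixList ω n) '' B)) := fun n =>
    (hbd.subset (wordComp_image_subset hB _)).closure
  have hdiam : Tendsto (fun n => diam (closure (wordComp f (prefixList ω n) '' B)))
      atTop (nhds 0) := by
    simpa only [diam_closure] using hf.tendsto_diam_prefixList hne hbd hcl ω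
  obtain ⟨a, ha⟩ := Metric.nonempty_iInter_of_nonempty_biInter (fun _ => isClosed_closure) hb
    (fun N => ((hne.image (wordComp f (prefixList ω N))).closure).mono
      (subset_iInter₂ fun n hn => closure_mono (hanti hn))) hdiam
  rw [mem_iInter] at ha
  refine ⟨a, Subset.antisymm (fun b hb' => ?_) ?_⟩
  · rw [mem_iInter₂] at hb'
    refine dist_le_zero.mp (ge_of_tendsto hdiam ?_)
    filter_upwards [eventually_ge_atTop 1] with n hn
    exact dist_le_diam_of_mem (hb n) (hb' n hn) (ha n)
  · rw [singleton_subset_iff, mem_iInter₂]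
    exact fun n _ => ha n

end

/-- **Proposition 3.1.** For a diameter diminishing to zero IFS `S = ((X,d),(f_i))`, for every
infinite word `ω ∈ Λ(I)` there exists `a_ω ∈ X` such that
`⋂_{n ≥ 1} closure (f_{[ω]_n}(B)) = {a_ω}` for every nonempty bounded closed `B` with
`F_S(B) ⊆ B`; in particular the intersection is a singleton independent of `B`. -/
theorem ddz_inter_singleton {X I : Type*} [MetricSpace X] [CompleteSpace X] [Nonempty X]
    [Finite I] [Nonempty I] (f : I → X → X)
    (hcont : ∀ i, Continuous (f i))
    (hbdd : ∀ i (B : Set X), IsBounded B → IsBounded (f i '' B))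
    (hddz : IsDDZ f) :
    ∀ ω : ℕ → I, ∃ a : X, ∀ B : Set X, B.Nonempty → IsBounded B → IsClosed B →
      fractalOp f B ⊆ B →
      (⋂ (n : ℕ) (_ : 1 ≤ n), closure (wordComp f (prefixList ω n) '' B)) = {a} := by
  intro ω
  have mono : ∀ {B M : Set X}, B ⊆ M →
      (⋂ (n : ℕ) (_ : 1 ≤ n), closure (wordComp f (prefixList ω n) '' B)) ⊆
        ⋂ (n : ℕ) (_ : 1 ≤ n), closure (wordComp f (prefixList ω n) '' M) := fun h =>
    iInter₂_mono fun _ _ => closure_mono (image_mono h)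
  obtain ⟨x⟩ := ‹Nonempty X›
  obtain ⟨K, hKne, hKb, hKc, -, hK, -⟩ :=
    hddz {x} (singleton_nonempty x) isBounded_singleton isClosed_singleton
  obtain ⟨a, ha⟩ := hddz.exists_iInter_eq_singleton hKne hKb hKc hK ω
  refine ⟨a, fun B hne hbd hcl hB => ?_⟩
  obtain ⟨b, hb⟩ := hddz.exists_iInter_eq_singleton hne hbd hcl hB ω
  obtain ⟨M, hMne, hMb, hMc, hsub, hM, -⟩ :=
    hddz (B ∪ K) (hne.mono subset_union_left) (hbd.union hKb) (hcl.union hKc)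
  obtain ⟨c, hc⟩ := hddz.exists_iInter_eq_singleton hMne hMb hMc hM ω
  have hac := mono (subset_union_right.trans hsub)
  have hbc := mono (subset_union_left.trans hsub)
  rw [ha, hc, singleton_subset_singleton] at hac
  rw [hb, hc, singleton_subset_singleton] at hbc
  rw [hb, hbc, hac]
end

section
/- Every diameter diminishing to zero IFS S = ((X,d),(f_i)_{i∈I}) has an attractor, namely A_S = π(Λ(I)) = {a_ω : ω ∈ Λ(I)}: this set is nonempty, compact, satisfies F_S(A_S) = A_S, and lim_{n→∞} H_d(F_S^[n](B), A_S) = 0 for every nonempty bounded closed set B ⊆ X, where H_d is the Hausdorff-Pompeiu distance. -/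
open Metric Set Filter Bornology

section Words

variable {I X : Type*}

lemma wordComp_prefixList_succ (f : I → X → X) (ω : ℕ → I) (n : ℕ) :
    wordComp f (prefixList ω (n + 1)) =
      f (ω 0) ∘ wordComp f (prefixList (fun k => ω (k + 1)) n) := by
  simp [prefixList, List.ofFn_succ, wordComp]

/-- The infinite word `iω`. -/
def consWord (i : I) (ω : ℕ → I) : ℕ → I
  | 0 => i
  | k + 1 => ω k

lemma wordComp_prefixList_consWord (f : I → X → X) (i : I) (ω : ℕ → I) (n : ℕ) :
    wordComp f (prefixList (consWord i ω) (n + 1)) = f i ∘ wordComp f (prefixList ω n) :=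
  wordComp_prefixList_succ f (consWord i ω) n

lemma consWord_head_tail (ω : ℕ → I) : consWord (ω 0) (fun k => ω (k + 1)) = ω := by
  funext k
  cases k <;> rfl

lemma mapsTo_wordComp {f : I → X → X} {M : Set X} (hf : ∀ i, MapsTo (f i) M M) (l : List I) :
    MapsTo (wordComp f l) M M := by
  induction l with
  | nil => exact mapsTo_id M
  | cons i l ih => exact (hf i).comp ih

lemma mem_iterate_iUnion_image [Nonempty I] (f : I → X → X) (S : Set X) (n : ℕ) (x : X) :
    x ∈ (fun T : Set X => ⋃ i, f i '' T)^[n] S ↔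
      ∃ ω : ℕ → I, ∃ y ∈ S, wordComp f (prefixList ω n) y = x := by
  induction n generalizing x with
  | zero => simp [prefixList, wordComp]
  | succ n ih =>
    rw [Function.iterate_succ_apply']
    simp only [mem_iUnion, mem_image, ih]
    constructor
    · rintro ⟨i, _, ⟨ω, y, hy, rfl⟩, rfl⟩
      exact ⟨consWord i ω, y, hy, by rw [wordComp_prefixList_consWord]; rfl⟩
    · rintro ⟨ω, y, hy, rfl⟩
      exact ⟨ω 0, _, ⟨fun k => ω (k + 1), y, hy, rfl⟩, by rw [wordComp_prefixList_succ]; rfl⟩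

lemma iUnion_image_range_eq {f : I → X → X} {π : (ℕ → I) → X}
    (h : ∀ i ω, f i (π ω) = π (consWord i ω)) : ⋃ i, f i '' range π = range π := by
  ext x
  simp only [mem_iUnion, mem_image, mem_range, exists_exists_eq_and, h]
  exact ⟨fun ⟨i, ω, hx⟩ => ⟨_, hx⟩,
    fun ⟨ω, hx⟩ => ⟨ω 0, fun k => ω (k + 1), by rw [consWord_head_tail, hx]⟩⟩

end Words

section FractalOperator

variable {I X : Type*} [MetricSpace X]

lemma mapsTo_of_fractalOp_subset {f : I → X → X} {M : Set X} (h : fractalOp f M ⊆ M) (i : I) :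
    MapsTo (f i) M M := fun _ hx =>
  h (subset_closure (mem_iUnion_of_mem i (mem_image_of_mem _ hx)))

lemma fractalOp_closure {f : I → X → X} (hcont : ∀ i, Continuous (f i)) (S : Set X) :
    fractalOp f (closure S) = closure (⋃ i, f i '' S) := by
  refine (closure_minimal (iUnion_subset fun i => ?_) isClosed_closure).antisymm
    (closure_mono (iUnion_mono fun i => image_mono subset_closure))
  exact (image_closure_subset_closure_image (hcont i)).trans
    (closure_mono (subset_iUnion (fun i => f i '' S) i))

lemma iterate_fractalOp {f : I → X → X} (hcont : ∀ i, Continuous (f i)) {B : Set X}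
    (hB : IsClosed B) (n : ℕ) :
    (fractalOp f)^[n] B = closure ((fun T : Set X => ⋃ i, f i '' T)^[n] B) := by
  induction n with
  | zero => exact hB.closure_eq.symm
  | succ n ih => rw [Function.iterate_succ_apply', Function.iterate_succ_apply', ih,
      fractalOp_closure hcont]

lemma dist_wordComp_le_iSup_diam [Finite I] {f : I → X → X} {M : Set X} (hM : IsBounded M)
    (hf : ∀ i, MapsTo (f i) M M) (ω : ℕ → I) (n : ℕ) {x a : X} (hx : x ∈ M)
    (ha : a ∈ closure (wordComp f (prefixList ω n) '' M)) :
    dist (wordComp f (prefixList ω n) x) a ≤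
      ⨆ σ : Fin n → I, diam (wordComp f (List.ofFn σ) '' M) := by
  have hb : IsBounded (wordComp f (prefixList ω n) '' M) :=
    hM.subset (mapsTo_wordComp hf _).image_subset
  calc dist (wordComp f (prefixList ω n) x) a
      ≤ diam (closure (wordComp f (prefixList ω n) '' M)) :=
        dist_le_diam_of_mem hb.closure (subset_closure (mem_image_of_mem _ hx)) ha
    _ = diam (wordComp f (prefixList ω n) '' M) := diam_closure _
    _ ≤ _ := le_ciSup (f := fun σ : Fin n → I => diam (wordComp f (List.ofFn σ) '' M))
        (Set.finite_range _).bddAbove fun k => ω k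

/-- If the word compositions at a point converge to `π` uniformly in the word, then the range of
`π` is compact. -/
lemma isCompact_range_of_tendstoUniformly [Finite I] {f : I → X → X} {π : (ℕ → I) → X} {x : X}
    (h : TendstoUniformly (fun n ω => wordComp f (prefixList ω n) x) π atTop) :
    IsCompact (range π) := by
  let _ : TopologicalSpace I := ⊥
  have : DiscreteTopology I := ⟨rfl⟩
  refine isCompact_range (h.continuous (Frequently.of_forall fun n => ?_))
  have hfac : (fun ω : ℕ → I => wordComp f (prefixList ω n) x) =
      (fun σ : Fin n → I => wordComp f (List.ofFn σ) x) ∘ fun ω k => ω k := rfl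
  rw [hfac]
  exact continuous_of_discreteTopology.comp (by fun_prop)

lemma apply_eq_consWord {f : I → X → X} (hcont : ∀ i, Continuous (f i)) {π : (ℕ → I) → X} {x : X}
    (h : ∀ ω, Tendsto (fun n => wordComp f (prefixList ω n) x) atTop (nhds (π ω)))
    (i : I) (ω : ℕ → I) : f i (π ω) = π (consWord i ω) := by
  refine tendsto_nhds_unique (((hcont i).tendsto _).comp (h ω)) ?_
  refine ((tendsto_add_atTop_iff_nat 1).2 (h (consWord i ω))).congr fun n => ?_
  rw [wordComp_prefixList_consWord]
  rfl

end FractalOperator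

/-- **Proposition 3.5.** Every diameter diminishing to zero IFS has an attractor, namely
`A_S = π(Λ(I)) = {a_ω : ω ∈ Λ(I)}`: this set is nonempty, compact, fixed by the fractal
operator, and attracts every nonempty bounded closed set in the Hausdorff-Pompeiu distance. -/
theorem ddz_has_attractor {X I : Type*} [MetricSpace X] [CompleteSpace X] [Nonempty X]
    [Finite I] [Nonempty I] (f : I → X → X)
    (hcont : ∀ i, Continuous (f i))
    (hbdd : ∀ i (B : Set X), IsBounded B → IsBounded (f i '' B))
    (hddz : IsDDZ f)
    (π : (ℕ → I) → X)
    (hπ : ∀ (ω : ℕ → I) (B : Set X), B.Nonempty → IsBounded B → IsClosed B →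
      fractalOp f B ⊆ B →
      (⋂ (n : ℕ) (_ : 1 ≤ n), closure (wordComp f (prefixList ω n) '' B)) = {π ω}) :
    (Set.range π).Nonempty ∧ IsCompact (Set.range π) ∧
      fractalOp f (Set.range π) = Set.range π ∧
      ∀ B : Set X, B.Nonempty → IsBounded B → IsClosed B →
        Tendsto (fun n : ℕ => hausdorffDist ((fractalOp f)^[n] B) (Set.range π))
          atTop (nhds 0) := by
  have key : ∀ M : Set X, M.Nonempty → IsBounded M → IsClosed M → fractalOp f M ⊆ M →
      ∀ n, 1 ≤ n → ∀ ω : ℕ → I, ∀ x ∈ M, dist (wordComp f (prefixList ω n) x) (π ω) ≤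
        ⨆ σ : Fin n → I, diam (wordComp f (List.ofFn σ) '' M) := by
    intro M hne hb hc hinv n hn ω x hx
    have hmem : π ω ∈ ⋂ (n : ℕ) (_ : 1 ≤ n), closure (wordComp f (prefixList ω n) '' M) :=
      hπ ω M hne hb hc hinv ▸ mem_singleton _
    exact dist_wordComp_le_iSup_diam hb (mapsTo_of_fractalOp_subset hinv) ω n hx
      (mem_iInter₂.1 hmem n hn)
  obtain ⟨x⟩ := ‹Nonempty X›
  have hunif : TendstoUniformly (fun n ω => wordComp f (prefixList ω n) x) π atTop := by
    obtain ⟨M, hne, hb, hc, hxM, hinv, hlim⟩ :=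
      hddz {x} (singleton_nonempty x) isBounded_singleton isClosed_singleton
    rw [Metric.tendstoUniformly_iff]
    intro ε hε
    filter_upwards [hlim.eventually_lt_const hε, eventually_ge_atTop 1] with n hn h1 ω
    rw [dist_comm]
    exact (key M hne hb hc hinv n h1 ω x (singleton_subset_iff.1 hxM)).trans_lt hn
  have hcompact := isCompact_range_of_tendstoUniformly hunif
  have hfix := iUnion_image_range_eq
    (apply_eq_consWord hcont fun ω => hunif.tendsto_at ω)
  refine ⟨range_nonempty π, hcompact, ?_, fun B hBne hBb hBc => ?_⟩
  · rw [fractalOp, hfix, hcompact.isClosed.closure_eq]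
  obtain ⟨M, hne, hb, hc, hBM, hinv, hlim⟩ := hddz B hBne hBb hBc
  refine squeeze_zero' (Eventually.of_forall fun n => hausdorffDist_nonneg) ?_ hlim
  filter_upwards [eventually_ge_atTop 1] with n hn
  rw [iterate_fractalOp hcont hBc, hausdorffDist_closure₁]
  refine hausdorffDist_le_of_mem_dist (Real.iSup_nonneg fun _ => diam_nonneg) ?_ ?_
  · intro z hz
    obtain ⟨ω, y, hy, rfl⟩ := (mem_iterate_iUnion_image f B n z).1 hz
    exact ⟨π ω, mem_range_self ω, key M hne hb hc hinv n hn ω y (hBM hy)⟩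
  · rintro _ ⟨ω, rfl⟩
    obtain ⟨y, hy⟩ := hBne
    refine ⟨_, (mem_iterate_iUnion_image f B n _).2 ⟨ω, y, hy, rfl⟩, ?_⟩
    rw [dist_comm]
    exact key M hne hb hc hinv n hn ω y (hBM hy)
end

section
/- Let S = ((X,d),(f_i)_{i∈I}) be an IFS and suppose there exists a comparison function φ such that every f_i is a φ-contraction (i.e. S is φ-contractive). Then S is a diameter diminishing to zero IFS: for every nonempty bounded closed B ⊆ X there exists a nonempty bounded closed M_B ⊆ X with B ⊆ M_B, F_S(M_B) ⊆ M_B, and lim_{n→∞} max_{ω∈I^n} diam(f_ω(M_B)) = 0. -/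
open Metric Set Filter Bornology

/-- `φ : [0,∞) → [0,∞)` is a comparison function: increasing, `φ(t) < t` for `t > 0`, and
right-continuous. -/
def IsComparisonFn (φ : ℝ → ℝ) : Prop :=
  (∀ t : ℝ, 0 ≤ t → 0 ≤ φ t) ∧ MonotoneOn φ (Set.Ici 0) ∧ (∀ t : ℝ, 0 < t → φ t < t) ∧
    ∀ t : ℝ, 0 ≤ t → ContinuousWithinAt φ (Set.Ici t) t

open TopologicalSpace in
/-- The union of the images of a nonempty compact set under finitely many continuous maps. -/
def imageUnion {X I : Type*} [MetricSpace X] [Finite I] [Nonempty I] (f : I → X → X)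
    (hf : ∀ i, Continuous (f i)) (K : NonemptyCompacts X) : NonemptyCompacts X :=
  ⟨⟨⋃ i, f i '' K, isCompact_iUnion fun i => K.isCompact.image (hf i)⟩,
    nonempty_iUnion.2 ⟨Classical.arbitrary I, K.nonempty.image _⟩⟩

namespace IsComparisonFn

variable {φ : ℝ → ℝ}

theorem map_zero (hφ : IsComparisonFn φ) : φ 0 = 0 := by
  refine le_antisymm (le_of_forall_pos_le_add fun ε hε => ?_) (hφ.1 0 le_rfl)
  have h1 := hφ.2.1 (mem_Ici.2 le_rfl) (mem_Ici.2 hε.le) hε.le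
  have h2 := hφ.2.2.1 ε hε
  linarith

theorem le_self (hφ : IsComparisonFn φ) {t : ℝ} (ht : 0 ≤ t) : φ t ≤ t := by
  rcases ht.eq_or_lt with rfl | h
  · exact hφ.map_zero.le
  · exact (hφ.2.2.1 t h).le

theorem iterate_nonneg (hφ : IsComparisonFn φ) {t : ℝ} (ht : 0 ≤ t) (n : ℕ) :
    0 ≤ φ^[n] t := by
  induction n with
  | zero => exact ht
  | succ n ih => rw [Function.iterate_succ_apply']; exact hφ.1 _ ih

/-- The iterates of a comparison function tend to zero. -/
theorem tendsto_iterate (hφ : IsComparisonFn φ) {t : ℝ} (ht : 0 ≤ t) :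
    Tendsto (fun n => φ^[n] t) atTop (nhds 0) := by
  have hanti : Antitone fun n => φ^[n] t := antitone_nat_of_succ_le fun n => by
    rw [Function.iterate_succ_apply']; exact hφ.le_self (hφ.iterate_nonneg ht n)
  have hbdd : BddBelow (range fun n => φ^[n] t) :=
    ⟨0, by rintro _ ⟨n, rfl⟩; exact hφ.iterate_nonneg ht n⟩
  have hlim := tendsto_atTop_ciInf hanti hbdd
  set L := ⨅ n, φ^[n] t
  have hL : 0 ≤ L := le_ciInf fun n => hφ.iterate_nonneg ht n
  have hφL : Tendsto (fun n => φ (φ^[n] t)) atTop (nhds (φ L)) :=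
    (hφ.2.2.2 L hL).tendsto.comp
      (tendsto_nhdsWithin_iff.2 ⟨hlim, Eventually.of_forall fun n => ciInf_le hbdd n⟩)
  have hsucc : Tendsto (fun n => φ (φ^[n] t)) atTop (nhds L) := by
    simpa only [Function.iterate_succ_apply', Function.comp_def] using
      hlim.comp (tendsto_add_atTop_nat 1)
  have hfix : φ L = L := tendsto_nhds_unique hφL hsucc
  have hL0 : L = 0 := by
    by_contra hne
    exact (hφ.2.2.1 L (lt_of_le_of_ne hL (Ne.symm hne))).ne hfix
  rwa [hL0] at hlim

/-- A `φ`-contraction is continuous. -/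
theorem continuous_of_contraction {Y : Type*} [MetricSpace Y] (hφ : IsComparisonFn φ) {g : Y → Y}
    (hg : ∀ x y, dist (g x) (g y) ≤ φ (dist x y)) : Continuous g :=
  (LipschitzWith.of_dist_le_mul (K := 1) fun x y => by
    simpa using (hg x y).trans (hφ.le_self dist_nonneg)).continuous

/-- A `φ`-contraction of a nonempty complete metric space has a fixed point. -/
theorem exists_fixedPoint {Y : Type*} [MetricSpace Y] [CompleteSpace Y] [Nonempty Y]
    (hφ : IsComparisonFn φ) {g : Y → Y} (hg : ∀ x y, dist (g x) (g y) ≤ φ (dist x y)) :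
    ∃ x, g x = x := by
  let x₀ : Y := Classical.arbitrary Y
  have hstep : ∀ n, dist (g^[n] x₀) (g^[n + 1] x₀) ≤ φ^[n] (dist x₀ (g x₀)) := by
    intro n
    induction n with
    | zero => simp
    | succ n ih =>
      rw [Function.iterate_succ_apply' g n, Function.iterate_succ_apply' g (n + 1),
        Function.iterate_succ_apply' φ]
      exact (hg _ _).trans
        (hφ.2.1 dist_nonneg (mem_Ici.2 (hφ.iterate_nonneg dist_nonneg n)) ih)
  have hcauchy : CauchySeq fun n => g^[n] x₀ := by
    rw [Metric.cauchySeq_iff']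
    intro ε hε
    have hε2 : 0 < ε / 2 := by positivity
    obtain ⟨N, hN⟩ := ((hφ.tendsto_iterate (dist_nonneg (x := x₀) (y := g x₀))).eventually
      (gt_mem_nhds (sub_pos.2 (hφ.2.2.1 _ hε2)))).exists
    refine ⟨N, fun n hn => ?_⟩
    have hball : dist (g^[n] x₀) (g^[N] x₀) ≤ ε / 2 := by
      induction n, hn using Nat.le_induction with
      | base => simpa using hε2.le
      | succ n _ ih =>
        have h1 := dist_triangle_right (g^[n + 1] x₀) (g^[N] x₀) (g^[N + 1] x₀)
        have h2 : dist (g^[n + 1] x₀) (g^[N + 1] x₀) ≤ φ (ε / 2) := by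
          rw [Function.iterate_succ_apply', Function.iterate_succ_apply']
          exact (hg _ _).trans (hφ.2.1 dist_nonneg (mem_Ici.2 hε2.le) ih)
        have h3 := hstep N
        linarith
    linarith
  obtain ⟨x, hx⟩ := cauchySeq_tendsto_of_complete hcauchy
  exact ⟨x, isFixedPt_of_tendsto_iterate hx (hφ.continuous_of_contraction hg).continuousAt⟩

open TopologicalSpace in
/-- The union of images under `φ`-contractions is a `φ`-contraction for the Hausdorff distance. -/
theorem dist_imageUnion_le {X I : Type*} [MetricSpace X] [Finite I] [Nonempty I]
    (hφ : IsComparisonFn φ) {f : I → X → X} (hf : ∀ i, Continuous (f i))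
    (hcontr : ∀ i x y, dist (f i x) (f i y) ≤ φ (dist x y)) (K L : NonemptyCompacts X) :
    dist (imageUnion f hf K) (imageUnion f hf L) ≤ φ (dist K L) := by
  have key : ∀ K L : NonemptyCompacts X, ∀ x ∈ ⋃ i, f i '' (K : Set X),
      ∃ y ∈ ⋃ i, f i '' (L : Set X), dist x y ≤ φ (dist K L) := by
    intro K L x hx
    obtain ⟨i, a, ha, rfl⟩ := mem_iUnion.1 hx
    obtain ⟨b, hb, hab⟩ := L.isCompact.exists_infDist_eq_dist L.nonempty a
    refine ⟨f i b, mem_iUnion.2 ⟨i, b, hb, rfl⟩, (hcontr i a b).trans ?_⟩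
    refine hφ.2.1 dist_nonneg dist_nonneg ?_
    rw [← hab, NonemptyCompacts.dist_eq]
    exact infDist_le_hausdorffDist_of_mem ha (hausdorffEDist_ne_top_of_nonempty_of_bounded
      K.nonempty L.nonempty K.isCompact.isBounded L.isCompact.isBounded)
  rw [NonemptyCompacts.dist_eq (x := imageUnion f hf K)]
  refine hausdorffDist_le_of_mem_dist (hφ.1 _ dist_nonneg) (key K L) ?_
  rw [dist_comm K L]
  exact key L K

/-- Composing `n` many `φ`-contractions contracts distances by the `n`-th iterate of `φ`. -/
theorem dist_wordComp_le {X I : Type*} [MetricSpace X] (hφ : IsComparisonFn φ) {f : I → X → X}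
    (hcontr : ∀ i x y, dist (f i x) (f i y) ≤ φ (dist x y)) (l : List I) {x y : X} {D : ℝ}
    (hD : dist x y ≤ D) :
    dist (wordComp f l x) (wordComp f l y) ≤ φ^[l.length] D := by
  induction l with
  | nil => simpa [wordComp] using hD
  | cons i l ih =>
    rw [List.length_cons, Function.iterate_succ_apply']
    exact (hcontr i _ _).trans
      (hφ.2.1 dist_nonneg (mem_Ici.2 (hφ.iterate_nonneg (dist_nonneg.trans hD) _)) ih)

end IsComparisonFn

/-- Part of **Theorem 4.1, 1 ⇒ 4.** If there is a comparison function `φ` such that every map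
of the IFS `S = ((X,d),(f_i))` is a `φ`-contraction, then `S` is a diameter diminishing to
zero IFS: every nonempty bounded closed `B` is contained in a nonempty bounded closed `M_B`
with `F_S(M_B) ⊆ M_B` and `max_{ω ∈ Iⁿ} diam (f_ω(M_B)) → 0`. -/
theorem phi_contractive_isDDZ {X I : Type*} [MetricSpace X] [CompleteSpace X]
    [Finite I] [Nonempty I] (f : I → X → X)
    (hcont : ∀ i, Continuous (f i))
    (hbdd : ∀ i (B : Set X), IsBounded B → IsBounded (f i '' B))
    (φ : ℝ → ℝ) (hφ : IsComparisonFn φ)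
    (hcontr : ∀ (i : I) (x y : X), dist (f i x) (f i y) ≤ φ (dist x y)) :
    IsDDZ f := by
  intro B hB hBb _
  obtain ⟨b, hb⟩ := hB
  have : Nonempty X := ⟨b⟩
  obtain ⟨A, hA⟩ := hφ.exists_fixedPoint (hφ.dist_imageUnion_le hcont hcontr)
  have hfA : ∀ i, ∀ a ∈ A, f i a ∈ A := fun i a ha => by
    rw [← hA]
    exact mem_iUnion.2 ⟨i, a, ha, rfl⟩
  obtain ⟨a₀, ha₀⟩ := A.nonempty
  obtain ⟨r, hr⟩ := hBb.subset_closedBall a₀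
  have hr0 : 0 ≤ r := dist_nonneg.trans (mem_closedBall.1 (hr hb))
  have hBM : B ⊆ cthickening r (A : Set X) := hr.trans (closedBall_subset_cthickening ha₀ r)
  have hMb : IsBounded (cthickening r (A : Set X)) := A.isCompact.isBounded.cthickening
  refine ⟨cthickening r (A : Set X), ⟨b, hBM hb⟩, hMb, isClosed_cthickening, hBM, ?_, ?_⟩
  · refine closure_minimal (iUnion_subset fun i => ?_) isClosed_cthickening
    rintro _ ⟨x, hx, rfl⟩
    rw [A.isCompact.cthickening_eq_biUnion_closedBall hr0] at hx
    obtain ⟨a, ha, hxa⟩ := mem_iUnion₂.1 hx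
    exact mem_cthickening_of_dist_le _ _ _ _ (hfA i a ha)
      ((hcontr i x a).trans ((hφ.le_self dist_nonneg).trans hxa))
  · refine squeeze_zero (fun n => Real.iSup_nonneg fun ω => diam_nonneg) (fun n => ?_)
      (hφ.tendsto_iterate (diam_nonneg (s := cthickening r (A : Set X))))
    refine ciSup_le fun ω => diam_le_of_forall_dist_le (hφ.iterate_nonneg diam_nonneg n) ?_
    rintro _ ⟨x, hx, rfl⟩ _ ⟨y, hy, rfl⟩
    simpa using hφ.dist_wordComp_le hcontr (List.ofFn ω) (dist_le_diam_of_mem hMb hx hy)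
end
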